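/- arXiv:2003.08696 — 6 statements merged into one kernel-verified Lean document; each statement's English description precedes it below -/
import Mathlib

section
/- Let Z be a real positive semidefinite symmetric (n+1)×(n+1) matrix with Z_{ii} = 1 for all i = 0, …, n. Then ⟨Z, Z⟩ ≤ (n+1)², and equality holds if and only if there exists z ∈ {−1, 1}^{n+1} such that Z = z zᵀ. -/
open Matrix BigOperators

lemma sq_one_cases {x : ℝ} (h : x ^ 2 = 1) : x = -1 ∨ x = 1 :=
  by
  have : (x + 1) * (x - 1) = 0 := by linarith
  rcases mul_eq_zero.1 this with h | h
  · left; linarith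
  · right; linarith

lemma quad_three {n : ℕ} {Z : Matrix (Fin (n + 1)) (Fin (n + 1)) ℝ}
    (hZ : Z.PosSemidef) (hdiag : ∀ i, Z i i = 1) (i j k : Fin (n + 1)) (a b c : ℝ) :
    0 ≤ a ^ 2 + b ^ 2 + c ^ 2 + 2 * a * b * Z i j + 2 * a * c * Z i k + 2 * b * c * Z j k := by
  have hs : ∀ p q, Z p q = Z q p := fun p q => by simpa using hZ.1.apply q p
  have h := hZ.dotProduct_mulVec_nonneg (Pi.single i a + Pi.single j b + Pi.single k c)
  simp only [star_trivial, mulVec_add, add_dotProduct, dotProduct_add, single_dotProduct,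
    mulVec_single, Pi.smul_apply, col_apply, MulOpposite.smul_eq_mul_unop,
    MulOpposite.unop_op, hdiag] at h
  rw [hs j i, hs k i, hs k j] at h
  linarith

/-- For PSD `Z` with unit diagonal, `⟨Z, Z⟩ ≤ (n+1)²`, with equality iff `Z = z zᵀ`
for some `z ∈ {-1, 1}^{n+1}`. -/
theorem frobenius_le_sq_of_unit_diag (n : ℕ) (Z : Matrix (Fin (n + 1)) (Fin (n + 1)) ℝ)
    (hZ : Z.PosSemidef) (hdiag : ∀ i, Z i i = 1) :
    Matrix.trace (Zᵀ * Z) ≤ ((n : ℝ) + 1) ^ 2 ∧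
      (Matrix.trace (Zᵀ * Z) = ((n : ℝ) + 1) ^ 2 ↔
        ∃ z : Fin (n + 1) → ℝ, (∀ i, z i = -1 ∨ z i = 1) ∧ Z = Matrix.vecMulVec z z) := by
  have hq := quad_three hZ hdiag
  have hle : ∀ i j, Z i j ^ 2 ≤ 1 := fun i j => by
    have := hq i j j (Z i j) (-1) 0
    nlinarith
  have htr : Matrix.trace (Zᵀ * Z) = ∑ p : Fin (n + 1) × Fin (n + 1), Z p.2 p.1 ^ 2 := by
    rw [Fintype.sum_prod_type]
    simp [Matrix.trace, Matrix.mul_apply, sq]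
  have hone : ((n : ℝ) + 1) ^ 2 = ∑ p : Fin (n + 1) × Fin (n + 1), (1 : ℝ) := by
    simp [sq]
  rw [htr, hone]
  refine ⟨Finset.sum_le_sum fun p _ => hle _ _, ?_⟩
  rw [Finset.sum_eq_sum_iff_of_le fun p _ => hle _ _]
  constructor
  · intro h
    have h1 : ∀ i j, Z i j ^ 2 = 1 := fun i j => h (j, i) (Finset.mem_univ _)
    refine ⟨fun i => Z 0 i, fun i => ((sq_one_cases (h1 0 i))), ?_⟩
    ext i j
    rw [vecMulVec_apply]
    have h2 := hq 0 i j 1 (-Z 0 i) (-Z 0 j)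
    rcases (sq_one_cases (h1 0 i)) with e1 | e1 <;>
    rcases (sq_one_cases (h1 0 j)) with e2 | e2 <;>
    rcases (sq_one_cases (h1 i j)) with e3 | e3 <;>
    rw [e1, e2, e3] at h2 ⊢ <;> first | (norm_num; done) | (norm_num at h2; done)
  · rintro ⟨z, hz, rfl⟩ p _
    rw [vecMulVec_apply]
    rcases hz p.1 with e | e <;> rcases hz p.2 with e' | e' <;> rw [e, e'] <;> norm_num
end

section
/- (Proposition 1, optimality part.) Let R be a real symmetric (n+1)×(n+1) matrix, and let z̃ ∈ {−1, 1}^{n+1} be such that ⟨R, z̃ z̃ᵀ⟩ ≤ ⟨R, Z⟩ for every matrix Z in the MAX-CUT feasible set. Then for every λ > 0 and every Z in the MAX-CUT feasible set, ⟨R, z̃ z̃ᵀ⟩ − λ (n+1)² ≤ ⟨R, Z⟩ − λ ⟨Z, Z⟩; that is, z̃ z̃ᵀ is a global minimizer of the penalized functional ⟨R, Z⟩ − λ ⟨Z, Z⟩ over the MAX-CUT feasible set. -/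
open Matrix BigOperators

/-- Proposition 1, optimality part: if `z̃ z̃ᵀ` minimizes `⟨R, ·⟩` over the MAX-CUT
feasible set, then for every `λ > 0` it is a global minimizer of the penalized
functional `⟨R, Z⟩ - λ ⟨Z, Z⟩` over the MAX-CUT feasible set. -/
theorem maxcut_penalized_optimality (n : ℕ) (R : Matrix (Fin (n + 1)) (Fin (n + 1)) ℝ)
    (hR : R.IsSymm) (zt : Fin (n + 1) → ℝ) (hzt : ∀ i, zt i = -1 ∨ zt i = 1)
    (hopt : ∀ Z : Matrix (Fin (n + 1)) (Fin (n + 1)) ℝ, Z.PosSemidef → (∀ i, Z i i = 1) →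
      Matrix.trace (Rᵀ * Matrix.vecMulVec zt zt) ≤ Matrix.trace (Rᵀ * Z))
    (lam : ℝ) (hlam : 0 < lam)
    (Z : Matrix (Fin (n + 1)) (Fin (n + 1)) ℝ) (hZ : Z.PosSemidef) (hZd : ∀ i, Z i i = 1) :
    Matrix.trace (Rᵀ * Matrix.vecMulVec zt zt) - lam * ((n : ℝ) + 1) ^ 2 ≤
      Matrix.trace (Rᵀ * Z) - lam * Matrix.trace (Zᵀ * Z) := by
  have h1 := hopt Z hZ hZd
  have hent : ∀ i j, Z i j * Z i j ≤ 1 := by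
    intro i j
    have h := (hZ.submatrix ![i, j]).det_nonneg
    have hs : Z j i = Z i j := by simpa using hZ.1.apply i j
    rw [Matrix.det_fin_two] at h
    simp [hZd, hs] at h
    linarith
  have h2 : Matrix.trace (Zᵀ * Z) ≤ ((n : ℝ) + 1) ^ 2 := by
    have : Matrix.trace (Zᵀ * Z) ≤ ∑ i : Fin (n + 1), ∑ j : Fin (n + 1), (1 : ℝ) := by
      simp only [Matrix.trace, Matrix.diag_apply, Matrix.mul_apply, Matrix.transpose_apply]
      exact Finset.sum_le_sum fun i _ => Finset.sum_le_sum fun j _ => hent j i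
    refine this.trans (le_of_eq ?_)
    simp
    ring
  have h3 := mul_le_mul_of_nonneg_left h2 hlam.le
  linarith
end

section
/- (Proposition 1, uniqueness part.) Let R be a real symmetric (n+1)×(n+1) matrix and z̃ ∈ {−1, 1}^{n+1}. Assume (a) ⟨R, z̃ z̃ᵀ⟩ ≤ ⟨R, Z⟩ for every Z in the MAX-CUT feasible set, and (b) for every z ∈ {−1, 1}^{n+1} with z zᵀ ≠ z̃ z̃ᵀ one has zᵀ R z > z̃ᵀ R z̃. Then for every λ > 0, z̃ z̃ᵀ is the unique global minimizer of ⟨R, Z⟩ − λ ⟨Z, Z⟩ over the MAX-CUT feasible set: every Z in the MAX-CUT feasible set with Z ≠ z̃ z̃ᵀ satisfies ⟨R, z̃ z̃ᵀ⟩ − λ (n+1)² < ⟨R, Z⟩ − λ ⟨Z, Z⟩. -/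
open Matrix BigOperators

lemma quad3 {m : ℕ} (Z : Matrix (Fin m) (Fin m) ℝ) (hZ : Z.PosSemidef) (hZd : ∀ i, Z i i = 1)
    (i j k : Fin m) (a b c : ℝ) :
    0 ≤ a ^ 2 + b ^ 2 + c ^ 2 + 2 * a * b * Z i j + 2 * a * c * Z i k + 2 * b * c * Z j k := by
  have hs : ∀ p q, Z p q = Z q p := fun p q => by
    have := hZ.1.apply q p
    simpa using this
  have h := hZ.dotProduct_mulVec_nonneg (a • Pi.single i 1 + b • Pi.single j 1 + c • Pi.single k 1)
  simp only [star_trivial, mulVec_add, mulVec_smul, add_dotProduct, dotProduct_add,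
    smul_dotProduct, dotProduct_smul, single_one_dotProduct, mulVec_single_one, col_apply,
    smul_eq_mul, hZd] at h
  rw [hs j i, hs k i, hs k j] at h
  linarith

lemma tr_vec {m : ℕ} (R : Matrix (Fin m) (Fin m) ℝ) (hR : R.IsSymm) (z : Fin m → ℝ) :
    Matrix.trace (Rᵀ * Matrix.vecMulVec z z) = z ⬝ᵥ (R *ᵥ z) := by
  rw [hR.eq, Matrix.mul_vecMulVec, Matrix.trace_vecMulVec, dotProduct_comm]

lemma sq_eq_one_or {x : ℝ} (h : x ^ 2 = 1) : x = 1 ∨ x = -1 := by simpa using h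

/-- Proposition 1, uniqueness part: under optimality of `z̃ z̃ᵀ` and strict optimality
of `z̃` among binary vectors, `z̃ z̃ᵀ` is the unique global minimizer of the penalized
functional over the MAX-CUT feasible set. -/
theorem maxcut_penalized_uniqueness (n : ℕ) (R : Matrix (Fin (n + 1)) (Fin (n + 1)) ℝ)
    (hR : R.IsSymm) (zt : Fin (n + 1) → ℝ) (hzt : ∀ i, zt i = -1 ∨ zt i = 1)
    (hopt : ∀ Z : Matrix (Fin (n + 1)) (Fin (n + 1)) ℝ, Z.PosSemidef → (∀ i, Z i i = 1) →
      Matrix.trace (Rᵀ * Matrix.vecMulVec zt zt) ≤ Matrix.trace (Rᵀ * Z))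
    (hstrict : ∀ z : Fin (n + 1) → ℝ, (∀ i, z i = -1 ∨ z i = 1) →
      Matrix.vecMulVec z z ≠ Matrix.vecMulVec zt zt →
      zt ⬝ᵥ (R *ᵥ zt) < z ⬝ᵥ (R *ᵥ z))
    (lam : ℝ) (hlam : 0 < lam)
    (Z : Matrix (Fin (n + 1)) (Fin (n + 1)) ℝ) (hZ : Z.PosSemidef) (hZd : ∀ i, Z i i = 1)
    (hne : Z ≠ Matrix.vecMulVec zt zt) :
    Matrix.trace (Rᵀ * Matrix.vecMulVec zt zt) - lam * ((n : ℝ) + 1) ^ 2 <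
      Matrix.trace (Rᵀ * Z) - lam * Matrix.trace (Zᵀ * Z) := by
  have hb : ∀ i j, Z i j ^ 2 ≤ 1 := fun i j => by
    have h1 := quad3 Z hZ hZd i j j 1 1 0
    have h2 := quad3 Z hZ hZd i j j 1 (-1) 0
    nlinarith
  have htr : Matrix.trace (Zᵀ * Z) = ∑ i, ∑ j, Z j i ^ 2 := by
    simp [Matrix.trace, Matrix.mul_apply, sq]
  have hcard : ((n : ℝ) + 1) ^ 2 = ∑ _i : Fin (n + 1), ∑ _j : Fin (n + 1), (1 : ℝ) := by
    simp [sq]; ring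
  by_cases hall : ∀ i j, Z i j ^ 2 = 1
  · have hprod : ∀ i j, Z i j = Z 0 i * Z 0 j := fun i j => by
      have h := quad3 Z hZ hZd 0 i j (-1) (Z 0 i) (Z 0 j)
      have hu := hall 0 i
      have hv := hall 0 j
      have hw := hall i j
      rcases sq_eq_one_or hu with hu | hu <;>
        rcases sq_eq_one_or hv with hv | hv <;>
        rcases sq_eq_one_or hw with hw | hw <;>
        rw [hu, hv, hw] at h <;> rw [hu, hv, hw] <;> first | (exfalso; norm_num at h; done) | norm_num
    have hZe : Z = Matrix.vecMulVec (Z 0) (Z 0) := by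
      ext i j
      rw [Matrix.vecMulVec_apply]; exact hprod i j
    have h1 := hstrict (Z 0) (fun i => (sq_eq_one_or (hall 0 i)).symm) (by rw [← hZe]; exact hne)
    rw [← tr_vec R hR, ← tr_vec R hR, ← hZe] at h1
    have h2 : Matrix.trace (Zᵀ * Z) = ((n : ℝ) + 1) ^ 2 := by
      rw [htr, hcard]; simp only [hall]
    rw [h2]; linarith
  · push Not at hall
    obtain ⟨p, q, hpq⟩ := hall
    have hlt : Matrix.trace (Zᵀ * Z) < ((n : ℝ) + 1) ^ 2 := by
      rw [htr, hcard]
      exact Finset.sum_lt_sum (fun i _ => Finset.sum_le_sum fun j _ => hb j i)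
        ⟨q, Finset.mem_univ _, Finset.sum_lt_sum (fun j _ => hb j q)
          ⟨p, Finset.mem_univ _, lt_of_le_of_ne (hb p q) hpq⟩⟩
    have := hopt Z hZ hZd
    have := mul_lt_mul_of_pos_left hlt hlam
    linarith
end

section
/- (Proposition 2.) Let Q be a real symmetric (n+1)×(n+1) matrix, k ∈ ℕ, and let x̃ ∈ {0, 1}^{n+1} with x̃_0 = 1 and Σ_{i=1}^{n} x̃_i = k. Assume that ⟨Q, x̃ x̃ᵀ⟩ ≤ ⟨Q, X⟩ for every X in the Boolean SDR feasible set. Then for every λ > 0 and every X in the Boolean SDR feasible set such that (k+1)·I − X is positive semidefinite (i.e., all eigenvalues of X are at most k+1), one has ⟨Q, x̃ x̃ᵀ⟩ + λ[(k+1) tr(x̃ x̃ᵀ) − ⟨x̃ x̃ᵀ, x̃ x̃ᵀ⟩] ≤ ⟨Q, X⟩ + λ[(k+1) tr X − ⟨X, X⟩]; that is, x̃ x̃ᵀ minimizes the penalized functional ⟨Q, X⟩ + λ[(k+1) tr X − ⟨X, X⟩] over such X. -/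
open Matrix BigOperators

/-- Proposition 2: if `x̃ x̃ᵀ` minimizes `⟨Q, ·⟩` over the Boolean SDR feasible set,
then for every `λ > 0` it minimizes the penalized functional
`⟨Q, X⟩ + λ [(k+1) tr X - ⟨X, X⟩]` over feasible `X` whose eigenvalues are at most `k+1`. -/
theorem boolean_sdr_penalized_optimality (n : ℕ) (Q : Matrix (Fin (n + 1)) (Fin (n + 1)) ℝ)
    (hQ : Q.IsSymm) (k : ℕ) (xt : Fin (n + 1) → ℝ)
    (hxt : ∀ i, xt i = 0 ∨ xt i = 1) (hxt0 : xt 0 = 1)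
    (hk : ∑ i ∈ Finset.univ.erase 0, xt i = (k : ℝ))
    (hopt : ∀ X : Matrix (Fin (n + 1)) (Fin (n + 1)) ℝ, X.PosSemidef → X 0 0 = 1 →
      (∀ i, i ≠ 0 → X i i = X 0 i) →
      Matrix.trace (Qᵀ * Matrix.vecMulVec xt xt) ≤ Matrix.trace (Qᵀ * X))
    (lam : ℝ) (hlam : 0 < lam)
    (X : Matrix (Fin (n + 1)) (Fin (n + 1)) ℝ) (hX : X.PosSemidef) (hX00 : X 0 0 = 1)
    (hXd : ∀ i, i ≠ 0 → X i i = X 0 i)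
    (hXev : (((k : ℝ) + 1) • (1 : Matrix (Fin (n + 1)) (Fin (n + 1)) ℝ) - X).PosSemidef) :
    Matrix.trace (Qᵀ * Matrix.vecMulVec xt xt) +
        lam * (((k : ℝ) + 1) * Matrix.trace (Matrix.vecMulVec xt xt) -
          Matrix.trace ((Matrix.vecMulVec xt xt)ᵀ * Matrix.vecMulVec xt xt)) ≤
      Matrix.trace (Qᵀ * X) +
        lam * (((k : ℝ) + 1) * Matrix.trace X - Matrix.trace (Xᵀ * X)) := by
  have h1 := hopt X hX hX00 hXd
  have hs : xt ⬝ᵥ xt = (k : ℝ) + 1 := by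
    have h : xt ⬝ᵥ xt = ∑ i, xt i := by
      unfold dotProduct
      refine Finset.sum_congr rfl fun i _ => ?_
      rcases hxt i with h | h <;> simp [h]
    rw [h, ← Finset.sum_erase_add Finset.univ xt (Finset.mem_univ 0), hk, hxt0]
  have h2 : Matrix.trace (Matrix.vecMulVec xt xt) = (k : ℝ) + 1 := by
    rw [Matrix.trace_vecMulVec, hs]
  have h3 : Matrix.trace ((Matrix.vecMulVec xt xt)ᵀ * Matrix.vecMulVec xt xt)
      = ((k : ℝ) + 1) * ((k : ℝ) + 1) := by
    rw [Matrix.transpose_vecMulVec, Matrix.vecMulVec_mul_vecMulVec, hs, Matrix.trace_vecMulVec]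
    simp [hs]
  have hXt : Xᵀ = X := by
    have := hX.isHermitian.eq
    rwa [Matrix.conjTranspose_eq_transpose_of_trivial] at this
  have h4 : 0 ≤ ((k : ℝ) + 1) * Matrix.trace X - Matrix.trace (Xᵀ * X) := by
    open scoped MatrixOrder Matrix.Norms.L2Operator in
    obtain ⟨B, hB⟩ := CStarAlgebra.nonneg_iff_eq_star_mul_self.mp hX.nonneg
    rw [Matrix.star_eq_conjTranspose] at hB
    have h5 := (hXev.mul_mul_conjTranspose_same B).trace_nonneg
    rw [Matrix.trace_mul_comm, ← Matrix.mul_assoc, ← hB] at h5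
    rw [hXt]
    simpa [Matrix.mul_sub, Matrix.trace_sub, Matrix.trace_smul] using h5
  rw [h2, h3]
  have := mul_nonneg hlam.le h4
  linarith
end

section
/- (Proposition 3, monotonicity of the descent algorithm.) Let M be a real symmetric (n+1)×(n+1) matrix, λ > 0, let K be a set of real positive semidefinite symmetric (n+1)×(n+1) matrices, and let (X_t)_{t∈ℕ} be a sequence in K such that for every t, X_{t+1} minimizes the linearized functional at X_t over K, i.e. ⟨M, X_{t+1}⟩ − λ ⟨X_t, X_{t+1}⟩ ≤ ⟨M, Y⟩ − λ ⟨X_t, Y⟩ for all Y ∈ K. Then the sequence F(X_t) := ⟨M, X_t⟩ − (λ/2) ⟨X_t, X_t⟩ is nonincreasing: F(X_{t+1}) ≤ F(X_t) for every t. -/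
open Matrix BigOperators

/-- Proposition 3, monotonicity of the descent algorithm: if each iterate `X (t+1)`
minimizes the linearized functional at `X t` over a set `K` of PSD matrices, then
`F (X t) = ⟨M, X t⟩ - (λ/2) ⟨X t, X t⟩` is nonincreasing. -/
theorem descent_monotone (n : ℕ) (M : Matrix (Fin (n + 1)) (Fin (n + 1)) ℝ) (hM : M.IsSymm)
    (lam : ℝ) (hlam : 0 < lam) (K : Set (Matrix (Fin (n + 1)) (Fin (n + 1)) ℝ))
    (hK : ∀ Z ∈ K, Z.PosSemidef) (X : ℕ → Matrix (Fin (n + 1)) (Fin (n + 1)) ℝ)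
    (hmem : ∀ t, X t ∈ K)
    (hmin : ∀ t, ∀ Y ∈ K,
      Matrix.trace (Mᵀ * X (t + 1)) - lam * Matrix.trace ((X t)ᵀ * X (t + 1)) ≤
        Matrix.trace (Mᵀ * Y) - lam * Matrix.trace ((X t)ᵀ * Y)) :
    ∀ t, Matrix.trace (Mᵀ * X (t + 1)) -
        (lam / 2) * Matrix.trace ((X (t + 1))ᵀ * X (t + 1)) ≤
      Matrix.trace (Mᵀ * X t) - (lam / 2) * Matrix.trace ((X t)ᵀ * X t) := by
  intro t
  have h1 := hmin t (X t) (hmem t)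
  have h2 : 0 ≤ Matrix.trace ((X (t + 1) - X t)ᵀ * (X (t + 1) - X t)) := by
    simp only [Matrix.trace, Matrix.diag_apply, Matrix.mul_apply, Matrix.transpose_apply]
    exact Finset.sum_nonneg fun i _ => Finset.sum_nonneg fun j _ => mul_self_nonneg _
  have h3 : Matrix.trace ((X (t + 1))ᵀ * X t) = Matrix.trace ((X t)ᵀ * X (t + 1)) := by
    rw [← Matrix.trace_transpose, Matrix.transpose_mul, Matrix.transpose_transpose]
  rw [Matrix.transpose_sub, Matrix.sub_mul, Matrix.mul_sub, Matrix.mul_sub, Matrix.trace_sub,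
    Matrix.trace_sub, Matrix.trace_sub, h3] at h2
  have h4 := mul_nonneg hlam.le h2
  linarith
end

section
/- Let X be a matrix in the Boolean SDR feasible set of rank 1. Then there exists x ∈ {0, 1}^{n+1} with x_0 = 1 such that X = x xᵀ; in particular x_i = X_{0i} for i = 1, …, n. -/
open Matrix BigOperators

/-- A rank-1 matrix in the Boolean SDR feasible set is `x xᵀ` for some binary `x` with
`x 0 = 1`; in particular `x i = X 0 i` for `i ≠ 0`. -/
theorem boolean_sdr_rank_one_extraction (n : ℕ) (X : Matrix (Fin (n + 1)) (Fin (n + 1)) ℝ)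
    (hX : X.PosSemidef) (hX00 : X 0 0 = 1) (hXd : ∀ i, i ≠ 0 → X i i = X 0 i)
    (hrank : X.rank = 1) :
    ∃ x : Fin (n + 1) → ℝ, (∀ i, x i = 0 ∨ x i = 1) ∧ x 0 = 1 ∧
      X = Matrix.vecMulVec x x ∧ ∀ i, i ≠ 0 → x i = X 0 i := by
  have hsym : ∀ i j, X i j = X j i := fun i j => by
    have := hX.1.apply i j
    simpa using this.symm
  rw [Matrix.rank_eq_finrank_span_cols] at hrank
  obtain ⟨v, -, hv⟩ := finrank_eq_one_iff'.1 hrank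
  have hc : ∀ j, ∃ c : ℝ, ∀ i, X i j = c * v.1 i := fun j => by
    obtain ⟨c, hc⟩ := hv ⟨X.col j, Submodule.subset_span ⟨j, rfl⟩⟩
    refine ⟨c, fun i => ?_⟩
    have := congrFun (congrArg Subtype.val hc) i
    simpa using this.symm
  choose c hc using hc
  have key : ∀ i j, X i j = X 0 i * X 0 j := fun i j => by
    have h0 : c 0 * v.1 0 = 1 := by rw [← hc, hX00]
    rw [hsym 0 i, hc j i, hc 0 i, hc j 0]
    linear_combination (-(c j * v.1 i)) * h0
  refine ⟨fun i => X 0 i, fun i => ?_, hX00, ?_, fun i _ => rfl⟩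
  · by_cases h : i = 0
    · right; rw [h]; exact hX00
    · have h1 := hXd i h
      rw [key i i] at h1
      have h2 : X 0 i * (X 0 i - 1) = 0 := by linarith
      rcases mul_eq_zero.1 h2 with h3 | h3
      · exact Or.inl h3
      · exact Or.inr (by linarith)
  · ext i j
    rw [Matrix.vecMulVec_apply]
    exact key i j
end
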